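/- Let r := √2 − 1 and ε := 1/203. Every weighted tetrahedron T with radii r_A = r_B = 1, r_C = r_D = r and edge lengths dist(A,B) ∈ [2, 2 + ε], dist(C,D) ∈ [2r, 2r + ε], and dist(A,C), dist(A,D), dist(B,C), dist(B,D) ∈ [1 + r, 1 + r + ε] satisfies δ(T) ≤ δ(T₀), where T₀ is any weighted tetrahedron with radii (1,1,r,r) and edge lengths dist(A,B) = 2, dist(C,D) = 2r, and the four mixed edges equal to 1 + r (the tight tetrahedron of type 11rr). -/

import Mathlib

open MeasureTheory Metric

noncomputable def tetra (A B C D : EuclideanSpace ℝ (Fin 3)) :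
    Set (EuclideanSpace ℝ (Fin 3)) :=
  convexHull ℝ {A, B, C, D}

noncomputable def density (A B C D : EuclideanSpace ℝ (Fin 3)) (rA rB rC rD : ℝ) : ℝ :=
  (volume (tetra A B C D ∩
    (closedBall A rA ∪ closedBall B rB ∪ closedBall C rC ∪ closedBall D rD))).toReal /
  (volume (tetra A B C D)).toReal


def sg (y : Fin 3 → ℝ) : ℝ := y 0 + y 1 + y 2
def orth : Set (Fin 3 → ℝ) := Set.univ.pi fun _ => Set.Ioi 0

lemma orth_meas : MeasurableSet orth := MeasurableSet.univ_pi fun _ => measurableSet_Ioi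
lemma mem_orth {y : Fin 3 → ℝ} : y ∈ orth ↔ ∀ i, 0 < y i := by simp [orth]
lemma sg_meas : Measurable sg := by unfold sg; fun_prop
lemma sg_pos {y : Fin 3 → ℝ} (h : y ∈ orth) : 0 < sg y := by
  rw [mem_orth] at h
  have := h 0; have := h 1; have := h 2
  unfold sg; positivity

lemma gam1 {s : ℝ} (hs : 0 < s) :
    ∫⁻ t in Set.Ioi (0:ℝ), ENNReal.ofReal (t^5 * s^6 * Real.exp (-(t*s)) / 120) = 1 := by
  have h := Real.integral_rpow_mul_exp_neg_mul_Ioi (a := 6) (r := s) (by norm_num) hs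
  have hG : Real.Gamma 6 = 120 := by
    rw [show (6:ℝ) = ((5:ℕ):ℝ)+1 by norm_num, Real.Gamma_nat_eq_factorial]
    norm_num [Nat.factorial]
  have e : ∀ t ∈ Set.Ioi (0:ℝ), t ^ ((6:ℝ) - 1) * Real.exp (-(s * t)) = t^5 * Real.exp (-(t*s)) := by
    intro t ht
    have : ((6:ℝ) - 1) = ((5:ℕ):ℝ) := by norm_num
    rw [this, Real.rpow_natCast, mul_comm s t]
  rw [setIntegral_congr_fun measurableSet_Ioi e, hG] at h
  have h2 : (1 / s) ^ (6:ℝ) = 1 / s^6 := by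
    have : (6:ℝ) = ((6:ℕ):ℝ) := by norm_num
    rw [this, Real.rpow_natCast]; simp
  rw [h2] at h
  have hintg : IntegrableOn (fun t : ℝ => t^5 * Real.exp (-(t*s))) (Set.Ioi 0) := by
    by_contra hc
    rw [integral_undef hc] at h
    have : 0 < 1 / s^6 * 120 := by positivity
    linarith
  rw [← ofReal_integral_eq_lintegral_ofReal]
  · have : ∀ t : ℝ, t^5 * s^6 * Real.exp (-(t*s)) / 120 = (s^6/120) * (t^5 * Real.exp (-(t*s))) := by
      intro t; ring
    simp_rw [this]
    rw [integral_const_mul, h]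
    have : s^6/120 * (1/s^6*120) = 1 := by field_simp
    rw [this]; simp
  · have : ∀ t : ℝ, t^5 * s^6 * Real.exp (-(t*s)) / 120 = (s^6/120) * (t^5 * Real.exp (-(t*s))) := by
      intro t; ring
    simp_rw [this]
    exact hintg.const_mul _
  · filter_upwards [ae_restrict_mem measurableSet_Ioi] with t ht
    have : 0 < t := ht
    positivity

lemma pow4 {c : ℝ} (hc : 0 < c) :
    ∫⁻ t in Set.Ioi c, ENNReal.ofReal (1 / t^4) = ENNReal.ofReal (1 / (3*c^3)) := by
  have e : ∀ t ∈ Set.Ioi c, t ^ (-4:ℝ) = 1 / t^4 := by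
    intro t ht
    have : 0 < t := hc.trans ht
    rw [Real.rpow_neg this.le]
    have : (4:ℝ) = ((4:ℕ):ℝ) := by norm_num
    rw [this, Real.rpow_natCast]; simp
  have hi := (integrableOn_Ioi_rpow_of_lt (a := -4) (by norm_num) hc).congr_fun e measurableSet_Ioi
  have h := integral_Ioi_rpow_of_lt (a := -4) (by norm_num) hc
  rw [setIntegral_congr_fun measurableSet_Ioi e] at h
  rw [← ofReal_integral_eq_lintegral_ofReal hi, h]
  · congr 1
    have : (-4 + 1 : ℝ) = -((3:ℕ):ℝ) := by norm_num
    rw [this, Real.rpow_neg hc.le, Real.rpow_natCast]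
    push_cast
    field_simp
  · filter_upwards [ae_restrict_mem measurableSet_Ioi] with t ht
    have : 0 < t := hc.trans ht
    positivity

lemma scale (f : (Fin 3 → ℝ) → ENNReal) (hf : Measurable f) {t : ℝ} (ht : 0 < t) :
    ∫⁻ y, f y = ENNReal.ofReal (1/t^3) * ∫⁻ z, f (t⁻¹ • z) := by
  have h := Measure.map_addHaar_smul (volume : Measure (Fin 3 → ℝ)) (inv_ne_zero ht.ne')
  have : ∫⁻ z, f (t⁻¹ • z) = ∫⁻ y, f y ∂(Measure.map (fun x => t⁻¹ • x) volume) := by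
    rw [lintegral_map hf (by fun_prop)]
  rw [this, h, lintegral_smul_measure]
  simp only [Module.finrank_fin_fun, smul_eq_mul]
  rw [← mul_assoc, ← ENNReal.ofReal_mul (by positivity)]
  have : 1/t^3 * |((t⁻¹)^3)⁻¹| = 1 := by
    rw [abs_of_pos (by positivity)]; field_simp
  rw [this]; simp

lemma vol_formula (N : (Fin 3 → ℝ) → ℝ) (hN : Measurable N)
    (hom : ∀ t : ℝ, 0 < t → ∀ y, N (t • y) = t * N y) (hpos : ∀ y ∈ orth, 0 < N y)
    {r : ℝ} (hr : 0 < r) :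
    volume (orth ∩ {y | N y ≤ r}) =
      ∫⁻ y in orth, ENNReal.ofReal (r^3/360 * (sg y^6 * Real.exp (-sg y) / N y^3)) := by
  have hms : MeasurableSet {y | N y ≤ r} := measurableSet_le hN measurable_const
  have hsg := sg_meas
  have hind : ∀ t : ℝ, MeasurableSet (orth ∩ {y | N y ≤ r * t}) := fun t =>
    orth_meas.inter (measurableSet_le hN measurable_const)
  calc volume (orth ∩ {y | N y ≤ r})
      = ∫⁻ y in orth ∩ {y | N y ≤ r}, 1 := by simp
    _ = ∫⁻ y in orth ∩ {y | N y ≤ r}, ∫⁻ t in Set.Ioi (0:ℝ),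
          ENNReal.ofReal (t^5 * sg y^6 * Real.exp (-(t*sg y)) / 120) := by
        refine setLIntegral_congr_fun (orth_meas.inter hms) ?_
        intro y hy
        exact (gam1 (sg_pos hy.1)).symm
    _ = ∫⁻ t in Set.Ioi (0:ℝ), ∫⁻ y in orth ∩ {y | N y ≤ r},
          ENNReal.ofReal (t^5 * sg y^6 * Real.exp (-(t*sg y)) / 120) := by
        rw [lintegral_lintegral_swap]
        apply Measurable.aemeasurable
        unfold Function.uncurry
        fun_prop
    _ = ∫⁻ t in Set.Ioi (0:ℝ), ∫⁻ y in orth, Set.indicator {p : ℝ × (Fin 3 → ℝ) | N p.2 ≤ r * p.1}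
          (fun p => ENNReal.ofReal (1/p.1^4) * ENNReal.ofReal (sg p.2^6 * Real.exp (-(sg p.2)) / 120)) (t, y) := by
        refine setLIntegral_congr_fun measurableSet_Ioi ?_
        intro t ht
        have ht : 0 < t := ht
        simp only
        rw [← lintegral_indicator (orth_meas.inter hms), ← lintegral_indicator orth_meas,
          scale _ (by
            apply Measurable.indicator _ (orth_meas.inter hms)
            fun_prop) ht, ← lintegral_const_mul' _ _ (by simp)]
        refine lintegral_congr fun z => ?_
        have h1 : t⁻¹ • z ∈ orth ↔ z ∈ orth := by
          simp [mem_orth, ht]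
        have h2 : N (t⁻¹ • z) ≤ r ↔ N z ≤ r * t := by
          rw [hom _ (by positivity), inv_mul_le_iff₀ ht, mul_comm]
        have h3 : sg (t⁻¹ • z) = t⁻¹ * sg z := by
          simp [sg]; ring
        by_cases hz : z ∈ orth
        · by_cases hz2 : N z ≤ r * t
          · rw [Set.indicator_of_mem (by exact ⟨h1.2 hz, h2.2 hz2⟩), Set.indicator_of_mem hz,
              Set.indicator_of_mem (by exact hz2)]
            rw [← ENNReal.ofReal_mul (by positivity), ← ENNReal.ofReal_mul (by positivity), h3]
            congr 1
            have : t * (t⁻¹ * sg z) = sg z := by field_simp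
            rw [this]
            field_simp
          · rw [Set.indicator_of_notMem (by intro h; exact hz2 (h2.1 h.2)), Set.indicator_of_mem hz,
              Set.indicator_of_notMem (by exact hz2)]
            simp
        · rw [Set.indicator_of_notMem (by intro h; exact hz (h1.1 h.1)), Set.indicator_of_notMem hz]
          simp
    _ = ∫⁻ y in orth, ∫⁻ t in Set.Ioi (0:ℝ), Set.indicator {p : ℝ × (Fin 3 → ℝ) | N p.2 ≤ r * p.1}
          (fun p => ENNReal.ofReal (1/p.1^4) * ENNReal.ofReal (sg p.2^6 * Real.exp (-(sg p.2)) / 120)) (t, y) := by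
        rw [lintegral_lintegral_swap]
        apply Measurable.aemeasurable
        unfold Function.uncurry
        apply Measurable.indicator
        · fun_prop
        · exact measurableSet_le (by fun_prop) (by fun_prop)
    _ = _ := by
        refine setLIntegral_congr_fun orth_meas ?_
        intro y hy
        simp only
        have hNy := hpos y hy
        have e : ∀ t : ℝ, Set.indicator {p : ℝ × (Fin 3 → ℝ) | N p.2 ≤ r * p.1}
          (fun p => ENNReal.ofReal (1/p.1^4) * ENNReal.ofReal (sg p.2^6 * Real.exp (-(sg p.2)) / 120)) (t, y)
          = Set.indicator (Set.Ici (N y / r)) (fun t => ENNReal.ofReal (1/t^4) * ENNReal.ofReal (sg y^6 * Real.exp (-(sg y)) / 120)) t := by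
          intro t
          simp only [Set.indicator, Set.mem_ofPred_eq, Set.mem_Ici, div_le_iff₀' hr]
        simp_rw [e]
        rw [setLIntegral_indicator measurableSet_Ici]
        have : Set.Ici (N y / r) ∩ Set.Ioi 0 = Set.Ici (N y / r) := by
          apply Set.inter_eq_left.2
          intro t ht
          have : N y / r ≤ t := ht
          exact lt_of_lt_of_le (by positivity) this
        rw [this, setLIntegral_congr Ioi_ae_eq_Ici.symm, lintegral_mul_const' _ _ (by simp),
          pow4 (by positivity), ← ENNReal.ofReal_mul (by positivity)]
        congr 1
        field_simp
        ring

lemma vol_real (N : (Fin 3 → ℝ) → ℝ) (hN : Measurable N)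
    (hom : ∀ t : ℝ, 0 < t → ∀ y, N (t • y) = t * N y) {μ : ℝ} (hμ : 0 < μ)
    (hpos : ∀ y ∈ orth, μ * sg y ≤ N y) {r : ℝ} (hr : 0 < r) :
    IntegrableOn (fun y => r^3/360 * (sg y^6 * Real.exp (-sg y) / N y^3)) orth ∧
    (volume (orth ∩ {y | N y ≤ r})).toReal =
      ∫ y in orth, r^3/360 * (sg y^6 * Real.exp (-sg y) / N y^3) := by
  have hp : ∀ y ∈ orth, 0 < N y := fun y hy =>
    lt_of_lt_of_le (mul_pos hμ (sg_pos hy)) (hpos y hy)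
  have h := vol_formula N hN hom hp hr
  have hfin : volume (orth ∩ {y | N y ≤ r}) < ⊤ := by
    refine lt_of_le_of_lt (measure_mono ?_) (measure_Icc_lt_top (a := (0 : Fin 3 → ℝ)) (b := fun _ => r/μ))
    rintro y ⟨hy, hy2⟩
    have h1 := hpos y hy
    have h2 : N y ≤ r := hy2
    have h3 : sg y ≤ r/μ := by rw [le_div_iff₀ hμ]; linarith
    rw [mem_orth] at hy
    have a0 := hy 0; have a1 := hy 1; have a2 := hy 2
    refine ⟨fun i => (hy i).le, fun i => ?_⟩
    unfold sg at h3
    fin_cases i <;> simp <;> linarith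
  have hnn : 0 ≤ᵐ[volume.restrict orth] fun y => r^3/360 * (sg y^6 * Real.exp (-sg y) / N y^3) := by
    filter_upwards [ae_restrict_mem orth_meas] with y hy
    have := hp y hy
    have := sg_pos hy
    positivity
  have hsg := sg_meas
  have hm : Measurable fun y => r^3/360 * (sg y^6 * Real.exp (-sg y) / N y^3) := by fun_prop
  have hi : IntegrableOn (fun y => r^3/360 * (sg y^6 * Real.exp (-sg y) / N y^3)) orth := by
    refine ⟨hm.aestronglyMeasurable, ?_⟩
    rw [hasFiniteIntegral_iff_ofReal hnn, ← h]
    exact hfin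
  refine ⟨hi, ?_⟩
  rw [h, ← ofReal_integral_eq_lintegral_ofReal hi hnn, ENNReal.toReal_ofReal]
  exact integral_nonneg_of_ae hnn

lemma gam_nat (k : ℕ) : IntegrableOn (fun t : ℝ => t^k * Real.exp (-t)) (Set.Ioi 0) ∧
    ∫ t in Set.Ioi (0:ℝ), t^k * Real.exp (-t) = (k.factorial : ℝ) := by
  have h := Real.Gamma_eq_integral (s := (k:ℝ)+1) (by positivity)
  have e : ∀ t ∈ Set.Ioi (0:ℝ), Real.exp (-t) * t ^ ((k:ℝ)+1 - 1) = t^k * Real.exp (-t) := by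
    intro t ht
    rw [add_sub_cancel_right, Real.rpow_natCast, mul_comm]
  rw [setIntegral_congr_fun measurableSet_Ioi e, Real.Gamma_nat_eq_factorial] at h
  exact ⟨(Real.GammaIntegral_convergent (s := (k:ℝ)+1) (by positivity)).congr_fun e measurableSet_Ioi, h.symm⟩

lemma moment (a b c : ℕ) :
    IntegrableOn (fun y : Fin 3 → ℝ => y 0^a * y 1^b * y 2^c * Real.exp (-sg y)) orth ∧
    ∫ y in orth, y 0^a * y 1^b * y 2^c * Real.exp (-sg y) =
      (a.factorial : ℝ) * b.factorial * c.factorial := by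
  have e : (fun y : Fin 3 → ℝ => y 0^a * y 1^b * y 2^c * Real.exp (-sg y)) =
      fun y => ∏ i, (fun t : ℝ => t ^ (![a,b,c] i) * Real.exp (-t)) (y i) := by
    funext y
    simp only [Fin.prod_univ_three, sg]
    simp only [Matrix.cons_val_zero, Matrix.cons_val_one, Matrix.cons_val]
    rw [show -(y 0 + y 1 + y 2) = -y 0 + -y 1 + -y 2 by ring, Real.exp_add, Real.exp_add]
    ring
  have hr : (volume : Measure (Fin 3 → ℝ)).restrict orth =
      Measure.pi fun _ : Fin 3 => (volume : Measure ℝ).restrict (Set.Ioi 0) := by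
    rw [volume_pi, orth, Measure.restrict_pi_pi]
  rw [IntegrableOn, hr, e]
  constructor
  · exact Integrable.fintype_prod (f := fun i t => t ^ (![a,b,c] i) * Real.exp (-t)) fun i => (gam_nat _).1
  · rw [integral_fintype_prod_eq_prod (f := fun i t => t ^ (![a,b,c] i) * Real.exp (-t)), Fin.prod_univ_three, (gam_nat _).2, (gam_nat _).2, (gam_nat _).2]
    simp

/-- integrals of cubic forms against exp(-σ) -/
lemma cubic (c0 c1 c2 c01 c02 c10 c12 c20 c21 c012 : ℝ) :
    IntegrableOn (fun y : Fin 3 → ℝ => (c0 * y 0^3 + c1 * y 1^3 + c2 * y 2^3 + c01 * (y 0^2 * y 1)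
      + c02 * (y 0^2 * y 2) + c10 * (y 1^2 * y 0) + c12 * (y 1^2 * y 2) + c20 * (y 2^2 * y 0)
      + c21 * (y 2^2 * y 1) + c012 * (y 0 * y 1 * y 2)) * Real.exp (-sg y)) orth ∧
    ∫ y in orth, (c0 * y 0^3 + c1 * y 1^3 + c2 * y 2^3 + c01 * (y 0^2 * y 1)
      + c02 * (y 0^2 * y 2) + c10 * (y 1^2 * y 0) + c12 * (y 1^2 * y 2) + c20 * (y 2^2 * y 0)
      + c21 * (y 2^2 * y 1) + c012 * (y 0 * y 1 * y 2)) * Real.exp (-sg y) =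
      6 * (c0 + c1 + c2) + 2 * (c01 + c02 + c10 + c12 + c20 + c21) + c012 := by
  have key : ∀ (a b : (Fin 3 → ℝ) → ℝ) (x z : ℝ),
      (IntegrableOn a orth ∧ ∫ y in orth, a y = x) → (IntegrableOn b orth ∧ ∫ y in orth, b y = z) →
      (IntegrableOn (fun y => a y + b y) orth ∧ ∫ y in orth, (a y + b y) = x + z) := by
    rintro a b x z ⟨ha, ha'⟩ ⟨hb, hb'⟩
    refine ⟨ha.add hb, ?_⟩
    rw [integral_add ha hb, ha', hb']
  have km : ∀ (c : ℝ) (i j k : ℕ),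
      (IntegrableOn (fun y : Fin 3 → ℝ => c * (y 0^i * y 1^j * y 2^k * Real.exp (-sg y))) orth ∧
       ∫ y in orth, c * (y 0^i * y 1^j * y 2^k * Real.exp (-sg y)) = c * ((i.factorial : ℝ) * j.factorial * k.factorial)) := by
    intro c i j k
    refine ⟨(moment i j k).1.const_mul c, ?_⟩
    rw [integral_const_mul, (moment i j k).2]
  have h := key _ _ _ _ (key _ _ _ _ (key _ _ _ _ (key _ _ _ _ (key _ _ _ _ (key _ _ _ _ (key _ _ _ _ (key _ _ _ _ (key _ _ _ _ (km c0 3 0 0) (km c1 0 3 0)) (km c2 0 0 3)) (km c01 2 1 0)) (km c02 2 0 1))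
    (km c10 1 2 0)) (km c12 0 2 1)) (km c20 1 0 2)) (km c21 0 1 2)) (km c012 1 1 1)
  convert! h using 2
  · funext y; ring
  · congr 1; funext y; ring
  · norm_num [Nat.factorial]; ring

def QF (d1 d2 d3 e12 e13 e23 : ℝ) (y : Fin 3 → ℝ) : ℝ :=
  sg y * (y 0 * d1 + y 1 * d2 + y 2 * d3) - y 0 * y 1 * e12 - y 0 * y 2 * e13 - y 1 * y 2 * e23

lemma convex_ineq {u v : ℝ} (hu : 0 < u) (hv : 0 < v) :
    1/u^3 ≤ 1/v^3 - 3/2 * (u^2 - v^2) * (1/u^5) := by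
  have : 0 ≤ 2*u^5 + 3*v^5 - 5*u^2*v^3 := by
    have : 2*u^5 + 3*v^5 - 5*u^2*v^3 = (u-v)^2 * (2*u^3+4*u^2*v+6*u*v^2+3*v^3) := by ring
    rw [this]; positivity
  rw [← sub_nonneg]
  have e : 1/v^3 - 3/2 * (u^2 - v^2) * (1/u^5) - 1/u^3 = (2*u^5 + 3*v^5 - 5*u^2*v^3)/(2*u^5*v^3) := by
    field_simp; ring
  rw [e]; positivity

lemma tangent_ineq {u s : ℝ} (hu : 0 < u) (hs : 0 < s) :
    7/2/s^5 - 5/2/s^7 * u^2 ≤ 1/u^5 := by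
  have : 0 ≤ 2*s^7 + 5*u^7 - 7*s^2*u^5 := by
    have : 2*s^7 + 5*u^7 - 7*s^2*u^5 = (u-s)^2 * (5*u^5+10*u^4*s+8*u^3*s^2+6*u^2*s^3+4*u*s^4+2*s^5) := by ring
    rw [this]; positivity
  rw [← sub_nonneg]
  have e : 1/u^5 - (7/2/s^5 - 5/2/s^7 * u^2) = (2*s^7 + 5*u^7 - 7*s^2*u^5)/(2*u^5*s^7) := by
    field_simp; ring
  rw [e]; positivity

noncomputable def Vf (d1 d2 d3 e12 e13 e23 r : ℝ) : ℝ :=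
  (volume (orth ∩ {y | Real.sqrt (QF d1 d2 d3 e12 e13 e23 y) ≤ r})).toReal

lemma QF_smul (d1 d2 d3 e12 e13 e23 t : ℝ) (y : Fin 3 → ℝ) :
    QF d1 d2 d3 e12 e13 e23 (t • y) = t^2 * QF d1 d2 d3 e12 e13 e23 y := by
  simp [QF, sg]; ring

lemma Vf_eq (d1 d2 d3 e12 e13 e23 : ℝ) {μ r : ℝ} (hμ : 0 < μ) (hr : 0 < r)
    (hQ : ∀ y ∈ orth, (μ * sg y)^2 ≤ QF d1 d2 d3 e12 e13 e23 y) :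
    IntegrableOn (fun y => r^3/360 * (sg y^6 * Real.exp (-sg y) /
      (Real.sqrt (QF d1 d2 d3 e12 e13 e23 y))^3)) orth ∧
    Vf d1 d2 d3 e12 e13 e23 r = ∫ y in orth, r^3/360 * (sg y^6 * Real.exp (-sg y) /
      (Real.sqrt (QF d1 d2 d3 e12 e13 e23 y))^3) := by
  apply vol_real (fun y => Real.sqrt (QF d1 d2 d3 e12 e13 e23 y)) _ _ hμ _ hr
  · have := sg_meas
    unfold QF
    fun_prop
  · intro t ht y
    rw [QF_smul, Real.sqrt_mul (by positivity), Real.sqrt_sq ht.le]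
  · intro y hy
    exact Real.le_sqrt_of_sq_le (hQ y hy)

lemma pointwise {σ N0 N1 p n μ Qu h1 h2 h3 y1 y2 y3 s1 s2 s3 : ℝ} (hσ : 0 < σ) (hμ : 0 < μ)
    (h0 : μ * σ ≤ N0) (h1' : μ * σ ≤ N1) (hu : N1^2 ≤ Qu) (hn : 0 ≤ n)
    (hdiff : N1^2 - N0^2 = σ * p - n) (hp : p = y1 * h1 + y2 * h2 + y3 * h3)
    (hh1 : 0 ≤ h1) (hh2 : 0 ≤ h2) (hh3 : 0 ≤ h3) (hy1 : 0 < y1) (hy2 : 0 < y2) (hy3 : 0 < y3)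
    (hs1 : 0 < s1) (hs2 : 0 < s2) (hs3 : 0 < s3) :
    σ^6 / N1^3 ≤ σ^6 / N0^3 - 3/2 * (
      y1 * h1 * (7/2/s1^5 * σ^2 - 5/2/s1^7 * Qu) + y2 * h2 * (7/2/s2^5 * σ^2 - 5/2/s2^7 * Qu)
      + y3 * h3 * (7/2/s3^5 * σ^2 - 5/2/s3^7 * Qu) - 1/μ^5 * σ * n) := by
  have hN0 : 0 < N0 := lt_of_lt_of_le (by positivity) h0
  have hN1 : 0 < N1 := lt_of_lt_of_le (by positivity) h1'
  have hu0 : 0 < N1/σ := by positivity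
  have hv0 : 0 < N0/σ := by positivity
  have hc := convex_ineq hu0 hv0
  have hc2 := mul_le_mul_of_nonneg_left hc (by positivity : 0 ≤ σ^3)
  have e1 : σ^3 * (1/(N1/σ)^3) = σ^6/N1^3 := by field_simp
  have e2 : σ^3 * (1 / (N0 / σ) ^ 3 - 3/2 * ((N1 / σ) ^ 2 - (N0 / σ) ^ 2) * (1 / (N1 / σ) ^ 5))
      = σ^6/N0^3 - 3/2 * (σ * (σ * p - n) * (1 / (N1 / σ) ^ 5)) := by
    rw [← hdiff]; field_simp
  rw [e1, e2] at hc2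
  set w := 1 / (N1 / σ) ^ 5 with hw
  have hM : w ≤ 1/μ^5 := by
    have : μ ≤ N1/σ := by rw [le_div_iff₀ hσ]; exact h1'
    rw [hw]
    gcongr
  have T : ∀ s, 0 < s → 7/2/s^5 * σ^2 - 5/2/s^7 * Qu ≤ σ^2 * w := by
    intro s hs
    have h := mul_le_mul_of_nonneg_left (tangent_ineq hu0 hs) (by positivity : 0 ≤ σ^2)
    have e : σ^2 * (7/2/s^5 - 5/2/s^7 * (N1/σ)^2) = 7/2/s^5 * σ^2 - 5/2/s^7 * N1^2 := by
      field_simp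
    rw [e] at h
    have : 5/2/s^7 * N1^2 ≤ 5/2/s^7 * Qu := by gcongr
    linarith
  have t1 := mul_le_mul_of_nonneg_left (T s1 hs1) (by positivity : 0 ≤ y1 * h1)
  have t2 := mul_le_mul_of_nonneg_left (T s2 hs2) (by positivity : 0 ≤ y2 * h2)
  have t3 := mul_le_mul_of_nonneg_left (T s3 hs3) (by positivity : 0 ≤ y3 * h3)
  have t4 := mul_le_mul_of_nonneg_left hM (by positivity : 0 ≤ σ * n)
  have e3 : σ * (σ * p - n) * w = y1 * h1 * (σ^2 * w) + y2 * h2 * (σ^2 * w) + y3 * h3 * (σ^2 * w)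
      - σ * n * w := by rw [hp]; ring
  rw [e3] at hc2
  linarith

lemma vertex (d1 d2 d3 e12 e13 e23 h1 h2 h3 k12 k13 k23 u1 u2 u3 l12 l13 l23 s1 s2 s3 : ℝ)
    {μ r : ℝ} (hμ : 0 < μ) (hr : 0 < r)
    (hQ0 : ∀ y ∈ orth, (μ * sg y)^2 ≤ QF d1 d2 d3 e12 e13 e23 y)
    (hQ1 : ∀ y ∈ orth, (μ * sg y)^2 ≤
      QF (d1+h1) (d2+h2) (d3+h3) (e12+k12) (e13+k13) (e23+k23) y)
    (hh1 : 0 ≤ h1) (hh2 : 0 ≤ h2) (hh3 : 0 ≤ h3)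
    (hk12 : 0 ≤ k12) (hk13 : 0 ≤ k13) (hk23 : 0 ≤ k23)
    (hu1 : d1 + h1 ≤ u1) (hu2 : d2 + h2 ≤ u2) (hu3 : d3 + h3 ≤ u3)
    (hl12 : l12 ≤ e12) (hl13 : l13 ≤ e13) (hl23 : l23 ≤ e23)
    (hs1 : 0 < s1) (hs2 : 0 < s2) (hs3 : 0 < s3) :
    Vf (d1+h1) (d2+h2) (d3+h3) (e12+k12) (e13+k13) (e23+k23) r ≤
      Vf d1 d2 d3 e12 e13 e23 r - r^3/240 * (
        h1 * (70/s1^5 - 5/2/s1^7 * (10*u1 + 5*u2 + 5*u3 - 2*l12 - 2*l13 - l23)) +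
        h2 * (70/s2^5 - 5/2/s2^7 * (5*u1 + 10*u2 + 5*u3 - 2*l12 - l13 - 2*l23)) +
        h3 * (70/s3^5 - 5/2/s3^7 * (5*u1 + 5*u2 + 10*u3 - l12 - 2*l13 - 2*l23))
        - 5/μ^5 * (k12 + k13 + k23)) := by
  obtain ⟨i0, v0⟩ := Vf_eq _ _ _ _ _ _ hμ hr hQ0
  obtain ⟨i1, v1⟩ := Vf_eq _ _ _ _ _ _ hμ hr hQ1
  rw [v0, v1]
  set a1 := 7/2/s1^5
  set a2 := 7/2/s2^5
  set a3 := 7/2/s3^5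
  set b1 := 5/2/s1^7
  set b2 := 5/2/s2^7
  set b3 := 5/2/s3^7
  set M := 1/μ^5 with hM
  -- the cubic form and its integral
  obtain ⟨ig, vg⟩ := cubic (h1*(a1-b1*u1)) (h2*(a2-b2*u2)) (h3*(a3-b3*u3))
    (h1*(2*a1-b1*(u1+u2-l12)) + h2*(a2-b2*u1) - M*k12)
    (h1*(2*a1-b1*(u1+u3-l13)) + h3*(a3-b3*u1) - M*k13)
    (h2*(2*a2-b2*(u1+u2-l12)) + h1*(a1-b1*u2) - M*k12)
    (h2*(2*a2-b2*(u2+u3-l23)) + h3*(a3-b3*u2) - M*k23)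
    (h3*(2*a3-b3*(u1+u3-l13)) + h1*(a1-b1*u3) - M*k13)
    (h3*(2*a3-b3*(u2+u3-l23)) + h2*(a2-b2*u3) - M*k23)
    (h1*(2*a1-b1*(u2+u3-l23)) + h2*(2*a2-b2*(u1+u3-l13)) + h3*(2*a3-b3*(u1+u2-l12))
      - M*(k12+k13+k23))
  have step := setIntegral_mono_on i1 (i0.sub (ig.const_mul (r^3/240))) orth_meas (by
    intro y hy
    have hσ := sg_pos hy
    have hy' := mem_orth.1 hy
    have y0 := hy' 0; have y1 := hy' 1; have y2 := hy' 2
    have q0 := hQ0 y hy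
    have q1 := hQ1 y hy
    have n0 := Real.le_sqrt_of_sq_le q0
    have n1 := Real.le_sqrt_of_sq_le q1
    have sq0 := Real.sq_sqrt ((sq_nonneg _).trans q0)
    have sq1 := Real.sq_sqrt ((sq_nonneg _).trans q1)
    have P := pointwise (σ := sg y) (p := y 0 * h1 + y 1 * h2 + y 2 * h3)
      (n := y 0 * y 1 * k12 + y 0 * y 2 * k13 + y 1 * y 2 * k23)
      (Qu := QF u1 u2 u3 l12 l13 l23 y) hσ hμ n0 n1 (by
        rw [sq1]; unfold QF; gcongr <;> linarith) (by positivity) (by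
        rw [sq0, sq1]; unfold QF; ring) rfl hh1 hh2 hh3 y0 y1 y2 hs1 hs2 hs3
    have P2 := mul_le_mul_of_nonneg_left P (by positivity : 0 ≤ r^3/360 * Real.exp (-sg y))
    refine le_trans (le_of_eq ?_) (P2.trans (le_of_eq ?_))
    · ring
    · simp only [Pi.sub_apply]
      unfold QF sg
      simp only [a1, a2, a3, b1, b2, b3, M]
      ring)
  refine step.trans (le_of_eq ?_)
  have := integral_sub i0 (ig.const_mul (r^3/240))
  simp only [Pi.sub_apply]
  rw [this, integral_const_mul (r^3/240), vg]
  congr 2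
  have : 5/μ^5 = 5 * M := by simp only [M]; ring
  rw [this]
  have : 70/s1^5 = 20*a1 := by simp only [a1]; ring
  rw [this]
  have : 70/s2^5 = 20*a2 := by simp only [a2]; ring
  rw [this]
  have : 70/s3^5 = 20*a3 := by simp only [a3]; ring
  rw [this]
  ring

abbrev E3 := EuclideanSpace ℝ (Fin 3)

def Dl : Set (Fin 3 → ℝ) := {y | (∀ i, 0 ≤ y i) ∧ sg y ≤ 1}

def Phi (u v w : E3) (y : Fin 3 → ℝ) : E3 := y 0 • u + y 1 • v + y 2 • w

noncomputable def PhiL (u v w : E3) : E3 →ₗ[ℝ] E3 where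
  toFun y := Phi u v w (WithLp.ofLp y)
  map_add' x y := by simp [Phi, add_smul]; abel
  map_smul' c x := by simp [Phi, mul_smul]

lemma Phi_norm (A B C D : E3) (y : Fin 3 → ℝ) :
    ‖Phi (B - A) (C - A) (D - A) y‖ = Real.sqrt (QF (dist A B^2) (dist A C^2) (dist A D^2)
      (dist B C^2) (dist B D^2) (dist C D^2) y) := by
  rw [EuclideanSpace.norm_eq]
  congr 1
  simp only [EuclideanSpace.dist_eq, Real.dist_eq, sq_abs, Fin.sum_univ_three, Real.norm_eq_abs]
  rw [Real.sq_sqrt (by positivity), Real.sq_sqrt (by positivity), Real.sq_sqrt (by positivity),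
    Real.sq_sqrt (by positivity), Real.sq_sqrt (by positivity), Real.sq_sqrt (by positivity)]
  simp [Phi, QF, sg]
  ring

lemma tetra_eq (A B C D : E3) :
    tetra A B C D = (fun y => A + Phi (B - A) (C - A) (D - A) y) '' Dl := by
  apply Set.Subset.antisymm
  · apply convexHull_min
    · rintro x (rfl | rfl | rfl | rfl)
      · exact ⟨![0,0,0], ⟨by intro i; fin_cases i <;> simp, by simp [sg]⟩, by simp [Phi]⟩
      · exact ⟨![1,0,0], ⟨by intro i; fin_cases i <;> simp, by simp [sg]⟩, by simp [Phi]⟩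
      · exact ⟨![0,1,0], ⟨by intro i; fin_cases i <;> simp, by simp [sg]⟩, by simp [Phi]⟩
      · exact ⟨![0,0,1], ⟨by intro i; fin_cases i <;> simp, by simp [sg]⟩, by simp [Phi]⟩
    · rintro _ ⟨y, ⟨hy, hy1⟩, rfl⟩ _ ⟨z, ⟨hz, hz1⟩, rfl⟩ a b ha hb hab
      refine ⟨a • y + b • z, ⟨fun i => ?_, ?_⟩, ?_⟩
      · have := hy i; have := hz i
        simp only [Pi.add_apply, Pi.smul_apply, smul_eq_mul]; positivity
      · have : sg (a • y + b • z) = a * sg y + b * sg z := by simp [sg]; ring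
        rw [this]; nlinarith
      · have : A = (a + b) • A := by rw [hab, one_smul]
        simp only [Phi, Pi.add_apply, Pi.smul_apply, smul_eq_mul]
        nth_rewrite 1 [this]
        module
  · rintro _ ⟨y, ⟨hy, hy1⟩, rfl⟩
    have h := (convex_convexHull ℝ ({A, B, C, D} : Set E3)).sum_mem (t := Finset.univ)
      (w := ![1 - sg y, y 0, y 1, y 2]) (z := ![A, B, C, D])
      (by intro i _; have := hy 0; have := hy 1; have := hy 2; fin_cases i <;> simp <;> linarith)
      (by simp [Fin.sum_univ_four, sg]; ring)
      (by intro i _; apply subset_convexHull; fin_cases i <;> simp)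
    convert! h using 1
    simp [Fin.sum_univ_four, Phi, sg]
    module

lemma lin_indep {A B C D : E3} (h : AffineIndependent ℝ ![A, B, C, D]) (y : Fin 3 → ℝ)
    (hy : Phi (B - A) (C - A) (D - A) y = 0) : y = 0 := by
  rw [affineIndependent_iff_linearIndependent_vsub ℝ _ 0] at h
  have h2 := h.comp (fun i : Fin 3 => (⟨i.succ, Fin.succ_ne_zero i⟩ : {x : Fin 4 // x ≠ 0}))
    (by intro i j hij; simpa using hij)
  rw [Fintype.linearIndependent_iff] at h2
  funext i
  apply h2 y
  simpa [Fin.sum_univ_three, Phi] using hy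

lemma Phi_vol {A B C D : E3} (h : AffineIndependent ℝ ![A, B, C, D]) :
    ∃ c : ℝ, 0 < c ∧ ∀ S : Set (Fin 3 → ℝ),
      volume ((fun y => A + Phi (B - A) (C - A) (D - A) y) '' S) = ENNReal.ofReal c * volume S := by
  refine ⟨|LinearMap.det (PhiL (B - A) (C - A) (D - A))|, ?_, ?_⟩
  · rw [abs_pos]
    have hinj : LinearMap.ker (PhiL (B - A) (C - A) (D - A)) = ⊥ := by
      rw [LinearMap.ker_eq_bot']
      intro v hv
      have := lin_indep h _ hv
      ext i
      exact congrFun this i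
    intro h0
    exact (LinearMap.bot_lt_ker_of_det_eq_zero h0).ne' hinj
  · intro S
    have e : (fun y => A + Phi (B - A) (C - A) (D - A) y) '' S =
        (fun x => A + x) '' (PhiL (B - A) (C - A) (D - A) '' ((WithLp.toLp 2) '' S)) := by
      rw [Set.image_image, Set.image_image]; rfl
    rw [e, Set.image_add_left, measure_preimage_add, Measure.addHaar_image_linearMap]
    congr 1
    have : (WithLp.toLp 2) '' S = (WithLp.ofLp : E3 → Fin 3 → ℝ) ⁻¹' S := by
      ext x; constructor
      · rintro ⟨y, hy, rfl⟩; exact hy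
      · intro hx; exact ⟨_, hx, rfl⟩
    rw [this]
    have hh := (EuclideanSpace.volume_preserving_symm_measurableEquiv_toLp (Fin 3))
    exact hh.measure_preimage_equiv S

lemma orth_ae : (Set.Ici (0 : Fin 3 → ℝ)) =ᵐ[volume] orth := 
  (Measure.univ_pi_Ioi_ae_eq_Ici (f := (0 : Fin 3 → ℝ))).symm

lemma ratio {A B C D : E3} (h : AffineIndependent ℝ ![A, B, C, D]) {d1 d2 d3 e12 e13 e23 μ r : ℝ}
    (h1 : dist A B ^2 = d1) (h2 : dist A C^2 = d2) (h3 : dist A D^2 = d3)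
    (h12 : dist B C ^2 = e12) (h13 : dist B D^2 = e13) (h23 : dist C D^2 = e23)
    (hμ : 0 < μ) (hr : r ≤ μ)
    (hQ : ∀ y ∈ orth, (μ * sg y)^2 ≤ QF d1 d2 d3 e12 e13 e23 y) :
    (volume (tetra A B C D ∩ closedBall A r)).toReal / (volume (tetra A B C D)).toReal =
      Vf d1 d2 d3 e12 e13 e23 r / (volume Dl).toReal := by
  obtain ⟨c, hc, hv⟩ := Phi_vol h
  have e : tetra A B C D ∩ closedBall A r = (fun y => A + Phi (B - A) (C - A) (D - A) y) ''
      (Dl ∩ {y | Real.sqrt (QF d1 d2 d3 e12 e13 e23 y) ≤ r}) := by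
    rw [tetra_eq, ← Set.image_inter_preimage]
    congr 2
    ext y
    simp only [Set.mem_preimage, mem_closedBall, dist_self_add_left, Phi_norm, h1, h2, h3, h12, h13, h23]
    rfl
  have e2 : (Dl ∩ {y | Real.sqrt (QF d1 d2 d3 e12 e13 e23 y) ≤ r} : Set _) =ᵐ[volume]
      (orth ∩ {y | Real.sqrt (QF d1 d2 d3 e12 e13 e23 y) ≤ r} : Set _) := by
    have a1 : Dl ∩ {y | Real.sqrt (QF d1 d2 d3 e12 e13 e23 y) ≤ r} =
        Set.Ici 0 ∩ ({y | sg y ≤ 1} ∩ {y | Real.sqrt (QF d1 d2 d3 e12 e13 e23 y) ≤ r}) := by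
      rw [← Set.inter_assoc]; rfl
    have a2 : orth ∩ {y | Real.sqrt (QF d1 d2 d3 e12 e13 e23 y) ≤ r} =
        orth ∩ ({y | sg y ≤ 1} ∩ {y | Real.sqrt (QF d1 d2 d3 e12 e13 e23 y) ≤ r}) := by
      ext y
      constructor
      · rintro ⟨hy, hy2⟩
        refine ⟨hy, ?_, hy2⟩
        have n := Real.le_sqrt_of_sq_le (hQ y hy)
        have hy2' : Real.sqrt (QF d1 d2 d3 e12 e13 e23 y) ≤ r := hy2
        have : μ * sg y ≤ μ * 1 := by linarith
        exact le_of_mul_le_mul_left this hμ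
      · rintro ⟨hy, _, hy2⟩
        exact ⟨hy, hy2⟩
    rw [a1, a2]
    exact orth_ae.inter (ae_eq_refl _)
  rw [e, hv, measure_congr e2, tetra_eq, hv, ENNReal.toReal_mul, ENNReal.toReal_mul,
    ENNReal.toReal_ofReal hc.le, mul_div_mul_left _ _ hc.ne']
  rfl

lemma ball_ae {x y : E3} {a b : ℝ} (h : a + b ≤ dist x y) :
    volume (closedBall x a ∩ closedBall y b) = 0 := by
  apply measure_mono_null _ (Measure.addHaar_sphere volume x a)
  rintro z ⟨h1, h2⟩
  rw [mem_closedBall] at h1 h2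
  rw [mem_sphere]
  have := dist_triangle x z y
  rw [dist_comm x z] at this
  linarith

lemma dens_le (A B C D : E3) (a b c d : ℝ) :
    density A B C D a b c d ≤
      (volume (tetra A B C D ∩ closedBall A a)).toReal / (volume (tetra A B C D)).toReal +
      (volume (tetra A B C D ∩ closedBall B b)).toReal / (volume (tetra A B C D)).toReal +
      (volume (tetra A B C D ∩ closedBall C c)).toReal / (volume (tetra A B C D)).toReal +
      (volume (tetra A B C D ∩ closedBall D d)).toReal / (volume (tetra A B C D)).toReal := by
  unfold density
  rw [← add_div, ← add_div, ← add_div]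
  refine div_le_div_of_nonneg_right ?_ ENNReal.toReal_nonneg
  have hf : ∀ (x : E3) (s : ℝ), volume (tetra A B C D ∩ closedBall x s) ≠ ⊤ := fun x s =>
    ((measure_mono Set.inter_subset_right).trans_lt measure_closedBall_lt_top).ne
  rw [Set.inter_union_distrib_left, Set.inter_union_distrib_left, Set.inter_union_distrib_left]
  have u := fun (s t : Set E3) => measureReal_union_le (μ := volume) s t
  simp only [measureReal_def] at u
  refine (u _ _).trans (add_le_add ((u _ _).trans (add_le_add (u _ _) le_rfl)) le_rfl)

lemma dens_eq {A B C D : E3} {a b c d : ℝ}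
    (hAB : a + b ≤ dist A B) (hAC : a + c ≤ dist A C) (hAD : a + d ≤ dist A D)
    (hBC : b + c ≤ dist B C) (hBD : b + d ≤ dist B D) (hCD : c + d ≤ dist C D) :
    density A B C D a b c d =
      (volume (tetra A B C D ∩ closedBall A a)).toReal / (volume (tetra A B C D)).toReal +
      (volume (tetra A B C D ∩ closedBall B b)).toReal / (volume (tetra A B C D)).toReal +
      (volume (tetra A B C D ∩ closedBall C c)).toReal / (volume (tetra A B C D)).toReal +
      (volume (tetra A B C D ∩ closedBall D d)).toReal / (volume (tetra A B C D)).toReal := by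
  unfold density
  rw [← add_div, ← add_div, ← add_div]
  congr 1
  have hf : ∀ (x : E3) (s : ℝ), volume (tetra A B C D ∩ closedBall x s) ≠ ⊤ := fun x s =>
    ((measure_mono Set.inter_subset_right).trans_lt measure_closedBall_lt_top).ne
  have hT : MeasurableSet (tetra A B C D) := by
    apply IsClosed.measurableSet
    apply IsCompact.isClosed
    apply Set.Finite.isCompact_convexHull
    exact Set.toFinite _
  have hm : ∀ (x : E3) (s : ℝ), NullMeasurableSet (tetra A B C D ∩ closedBall x s) volume :=
    fun x s => (hT.inter measurableSet_closedBall).nullMeasurableSet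
  have hd : ∀ (x y : E3) (s t : ℝ), s + t ≤ dist x y →
      AEDisjoint volume (tetra A B C D ∩ closedBall x s) (tetra A B C D ∩ closedBall y t) := by
    intro x y s t h
    apply measure_mono_null _ (ball_ae h)
    rintro z ⟨h1, h2⟩
    exact ⟨h1.2, h2.2⟩
  rw [Set.inter_union_distrib_left, Set.inter_union_distrib_left, Set.inter_union_distrib_left]
  rw [measure_union₀ (hm _ _) (((hd _ _ _ _ hAD).union_left (hd _ _ _ _ hBD)).union_left (hd _ _ _ _ hCD)),
    measure_union₀ (hm _ _) ((hd _ _ _ _ hAC).union_left (hd _ _ _ _ hBC)),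
    measure_union₀ (hm _ _) (hd _ _ _ _ hAB)]
  have f := hf
  rw [ENNReal.toReal_add (by simp [hf]) (hf _ _), ENNReal.toReal_add (by simp [hf]) (hf _ _),
    ENNReal.toReal_add (hf _ _) (hf _ _)]

lemma QF_big {d1 d2 d3 e12 e13 e23 : ℝ} (h1 : 4 ≤ d1) (h2 : 2 ≤ d2) (h3 : 2 ≤ d3)
    (h12 : e12 ≤ 2.014) (h13 : e13 ≤ 2.014) (h23 : e23 ≤ 0.695) :
    ∀ y ∈ orth, (13/10 * sg y)^2 ≤ QF d1 d2 d3 e12 e13 e23 y := by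
  intro y hy
  have hσ := sg_pos hy
  have hy' := mem_orth.1 hy
  have y0 := hy' 0; have y1 := hy' 1; have y2 := hy' 2
  have : QF 4 2 2 2.014 2.014 0.695 y ≤ QF d1 d2 d3 e12 e13 e23 y := by
    unfold QF; gcongr
  refine le_trans ?_ this
  unfold QF sg
  nlinarith [mul_pos y0 y1, mul_pos y0 y2, mul_pos y1 y2, sq_nonneg (y 1 - y 2), sq_nonneg (y 0)]

lemma QF_small {d1 d2 d3 e12 e13 e23 : ℝ} (h1 : 0.686 ≤ d1) (h2 : 2 ≤ d2) (h3 : 2 ≤ d3)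
    (h12 : e12 ≤ 2.014) (h13 : e13 ≤ 2.014) (h23 : e23 ≤ 4.02) :
    ∀ y ∈ orth, (73/100 * sg y)^2 ≤ QF d1 d2 d3 e12 e13 e23 y := by
  intro y hy
  have hσ := sg_pos hy
  have hy' := mem_orth.1 hy
  have y0 := hy' 0; have y1 := hy' 1; have y2 := hy' 2
  have : QF 0.686 2 2 2.014 2.014 4.02 y ≤ QF d1 d2 d3 e12 e13 e23 y := by
    unfold QF; gcongr
  refine le_trans ?_ this
  unfold QF sg
  nlinarith [mul_pos y1 y2, sq_nonneg (y 1 - y 2), sq_nonneg (y 0 - 1.286 * (y 1 + y 2))]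

lemma aff_perm {p q : Fin 4 → E3} (h : AffineIndependent ℝ p) (e : Equiv.Perm (Fin 4))
    (hq : q = p ∘ e) : AffineIndependent ℝ q := by
  rw [hq]; exact h.comp_embedding e.toEmbedding

/-- The density of four balls of the given radii as a sum of the four normalized vertex volumes. -/
lemma parts {A B C D : E3} (haff : AffineIndependent ℝ ![A, B, C, D]) {r ab ac ad bc bd cd : ℝ}
    (hr : r ≤ 73/100)
    (h1 : dist A B ^ 2 = ab) (h2 : dist A C ^ 2 = ac) (h3 : dist A D ^ 2 = ad)
    (h4 : dist B C ^ 2 = bc) (h5 : dist B D ^ 2 = bd) (h6 : dist C D ^ 2 = cd)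
    (lab : 4 ≤ ab) (lac : 2 ≤ ac) (lad : 2 ≤ ad) (lbc : 2 ≤ bc) (lbd : 2 ≤ bd) (lcd : 0.686 ≤ cd)
    (uab : ab ≤ 4.02) (uac : ac ≤ 2.014) (uad : ad ≤ 2.014) (ubc : bc ≤ 2.014) (ubd : bd ≤ 2.014)
    (ucd : cd ≤ 0.695) :
      (volume (tetra A B C D ∩ closedBall A 1)).toReal / (volume (tetra A B C D)).toReal +
      (volume (tetra A B C D ∩ closedBall B 1)).toReal / (volume (tetra A B C D)).toReal +
      (volume (tetra A B C D ∩ closedBall C r)).toReal / (volume (tetra A B C D)).toReal +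
      (volume (tetra A B C D ∩ closedBall D r)).toReal / (volume (tetra A B C D)).toReal =
      (Vf ab ac ad bc bd cd 1 + Vf ab bc bd ac ad cd 1 + Vf cd ac bc ad bd ab r +
        Vf cd ad bd ac bc ab r) / (volume Dl).toReal := by
  have tB : tetra A B C D = tetra B A C D := by
    unfold tetra; congr 1; ext x; simp; tauto
  have tC : tetra A B C D = tetra C D A B := by
    unfold tetra; congr 1; ext x; simp; tauto
  have tD : tetra A B C D = tetra D C A B := by
    unfold tetra; congr 1; ext x; simp; tauto
  have aB : AffineIndependent ℝ ![B, A, C, D] := aff_perm haff (Equiv.swap 0 1) (by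
    funext i; fin_cases i <;> rfl)
  have aC : AffineIndependent ℝ ![C, D, A, B] := aff_perm haff (Equiv.swap 0 2 * Equiv.swap 1 3) (by
    funext i; fin_cases i <;> rfl)
  have aD : AffineIndependent ℝ ![D, C, A, B] := aff_perm aC (Equiv.swap 0 1) (by
    funext i; fin_cases i <;> rfl)
  have rA := ratio haff (r := 1) h1 h2 h3 h4 h5 h6 (by norm_num) (by norm_num)
    (QF_big lab lac lad ubc ubd ucd)
  have rB := ratio aB (r := 1) (by rw [dist_comm, h1]) h4 h5 h2 h3 h6 (by norm_num) (by norm_num)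
    (QF_big lab lbc lbd uac uad ucd)
  have rC := ratio aC (r := r) h6 (by rw [dist_comm, h2]) (by rw [dist_comm, h4])
    (by rw [dist_comm, h3]) (by rw [dist_comm, h5]) h1 (by norm_num) hr
    (QF_small lcd lac lbc uad ubd uab)
  have rD := ratio aD (r := r) (by rw [dist_comm, h6]) (by rw [dist_comm, h3]) (by rw [dist_comm, h5])
    (by rw [dist_comm, h2]) (by rw [dist_comm, h4]) h1 (by norm_num) hr
    (QF_small lcd lad lbd uac ubc uab)
  rw [← tB] at rB
  rw [← tC] at rC
  rw [← tD] at rD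
  rw [rA, rB, rC, rD, ← add_div, ← add_div, ← add_div]

lemma main_ineq {r q hab hac had hbc hbd hcd : ℝ} (hr0 : 0 < r)
    (hr1 : 0.071 ≤ r^3) (hr2 : r^3 ≤ 0.0711) (hq : 0.686 ≤ q)
    (lab : 0 ≤ hab) (lac : 0 ≤ hac) (lad : 0 ≤ had) (lbc : 0 ≤ hbc) (lbd : 0 ≤ hbd) (lcd : 0 ≤ hcd)
    (uab : 4 + hab ≤ 4.02) (uac : 2 + hac ≤ 2.014) (uad : 2 + had ≤ 2.014) (ubc : 2 + hbc ≤ 2.014)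
    (ubd : 2 + hbd ≤ 2.014) (ucd : q + hcd ≤ 0.695) :
    Vf (4+hab) (2+hac) (2+had) (2+hbc) (2+hbd) (q+hcd) 1 +
      Vf (4+hab) (2+hbc) (2+hbd) (2+hac) (2+had) (q+hcd) 1 +
      Vf (q+hcd) (2+hac) (2+hbc) (2+had) (2+hbd) (4+hab) r +
      Vf (q+hcd) (2+had) (2+hbd) (2+hac) (2+hbc) (4+hab) r ≤
    Vf 4 2 2 2 2 q 1 + Vf 4 2 2 2 2 q 1 + Vf q 2 2 2 2 4 r + Vf q 2 2 2 2 4 r := by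
  have big : ∀ a b c d e f : ℝ, 0 ≤ a → 0 ≤ b → 0 ≤ c → 0 ≤ d → 0 ≤ e → 0 ≤ f →
      4 + a ≤ 4.02 → 2 + b ≤ 2.014 → 2 + c ≤ 2.014 → 2 + d ≤ 2.014 → 2 + e ≤ 2.014 →
      q + f ≤ 0.695 → _ := fun a b c d e f a0 b0 c0 d0 e0 f0 a1 b1 c1 d1 e1 f1 =>
    vertex 4 2 2 2 2 q a b c d e f 4.02 2.014 2.014 2 2 0.686 (8/5) (3/2) (3/2) (μ := 13/10) (r := 1)
      (by norm_num) (by norm_num)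
      (QF_big (by norm_num) (by norm_num) (by norm_num) (by norm_num) (by norm_num) (by linarith))
      (QF_big (by linarith) (by linarith) (by linarith) d1 e1 f1)
      a0 b0 c0 d0 e0 f0 a1 b1 c1 le_rfl le_rfl hq (by norm_num) (by norm_num) (by norm_num)
  have small : ∀ a b c d e f : ℝ, 0 ≤ a → 0 ≤ b → 0 ≤ c → 0 ≤ d → 0 ≤ e → 0 ≤ f →
      q + a ≤ 0.695 → 2 + b ≤ 2.014 → 2 + c ≤ 2.014 → 2 + d ≤ 2.014 → 2 + e ≤ 2.014 →
      4 + f ≤ 4.02 → _ := fun a b c d e f a0 b0 c0 d0 e0 f0 a1 b1 c1 d1 e1 f1 =>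
    vertex q 2 2 2 2 4 a b c d e f 0.695 2.014 2.014 2 2 4 (9/10) 1 1 (μ := 73/100) (r := r)
      (by norm_num) hr0
      (QF_small (by linarith) (by norm_num) (by norm_num) (by norm_num) (by norm_num) (by norm_num))
      (QF_small (by linarith) (by linarith) (by linarith) d1 e1 f1)
      a0 b0 c0 d0 e0 f0 a1 b1 c1 le_rfl le_rfl le_rfl (by norm_num) (by norm_num) (by norm_num)
  have vA := big hab hac had hbc hbd hcd lab lac lad lbc lbd lcd uab uac uad ubc ubd ucd
  have vB := big hab hbc hbd hac had hcd lab lbc lbd lac lad lcd uab ubc ubd uac uad ucd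
  have vC := small hcd hac hbc had hbd hab lcd lac lbc lad lbd lab ucd uac ubc uad ubd uab
  have vD := small hcd had hbd hac hbc hab lcd lad lbd lac lbc lab ucd uad ubd uac ubc uab
  generalize r^3 = ρ at *
  norm_num at vA vB vC vD hr1 hr2
  have p1 := mul_nonneg lab (sub_nonneg.2 hr2)
  have p2 := mul_nonneg lac (sub_nonneg.2 hr2)
  have p3 := mul_nonneg lad (sub_nonneg.2 hr2)
  have p4 := mul_nonneg lbc (sub_nonneg.2 hr2)
  have p5 := mul_nonneg lbd (sub_nonneg.2 hr2)
  have p6 := mul_nonneg lcd (sub_nonneg.2 hr1)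
  nlinarith [p1, p2, p3, p4, p5, p6]

/-- With ε = 1/203, every weighted tetrahedron of type 11rr with edge lengths within ε
of the tight ones is at most as dense as the tight tetrahedron of type 11rr. -/
theorem local_11rr
    (A B C D A₀ B₀ C₀ D₀ : EuclideanSpace ℝ (Fin 3))
    (haff : AffineIndependent ℝ ![A, B, C, D])
    (hAB : dist A B ∈ Set.Icc (2 : ℝ) (2 + 1 / 203))
    (hCD : dist C D ∈ Set.Icc (2 * (Real.sqrt 2 - 1)) (2 * (Real.sqrt 2 - 1) + 1 / 203))
    (hAC : dist A C ∈ Set.Icc (1 + (Real.sqrt 2 - 1)) (1 + (Real.sqrt 2 - 1) + 1 / 203))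
    (hAD : dist A D ∈ Set.Icc (1 + (Real.sqrt 2 - 1)) (1 + (Real.sqrt 2 - 1) + 1 / 203))
    (hBC : dist B C ∈ Set.Icc (1 + (Real.sqrt 2 - 1)) (1 + (Real.sqrt 2 - 1) + 1 / 203))
    (hBD : dist B D ∈ Set.Icc (1 + (Real.sqrt 2 - 1)) (1 + (Real.sqrt 2 - 1) + 1 / 203))
    (haff₀ : AffineIndependent ℝ ![A₀, B₀, C₀, D₀])
    (hAB₀ : dist A₀ B₀ = 2) (hCD₀ : dist C₀ D₀ = 2 * (Real.sqrt 2 - 1))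
    (hAC₀ : dist A₀ C₀ = 1 + (Real.sqrt 2 - 1)) (hAD₀ : dist A₀ D₀ = 1 + (Real.sqrt 2 - 1))
    (hBC₀ : dist B₀ C₀ = 1 + (Real.sqrt 2 - 1)) (hBD₀ : dist B₀ D₀ = 1 + (Real.sqrt 2 - 1)) :
    density A B C D 1 1 (Real.sqrt 2 - 1) (Real.sqrt 2 - 1) ≤
      density A₀ B₀ C₀ D₀ 1 1 (Real.sqrt 2 - 1) (Real.sqrt 2 - 1) := by
  have s2 := Real.sq_sqrt (show (0:ℝ) ≤ 2 by norm_num)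
  have sl : (1.41421:ℝ) ≤ Real.sqrt 2 := Real.le_sqrt_of_sq_le (by norm_num)
  have su : Real.sqrt 2 ≤ 1.41422 := by
    rw [Real.sqrt_le_iff]; norm_num
  set t := Real.sqrt 2 with ht
  have mixed : ∀ x ∈ Set.Icc (1 + (t - 1)) (1 + (t - 1) + 1/203), 0 ≤ x^2 - 2 ∧ 2 + (x^2 - 2) ≤ 2.014 := by
    rintro x ⟨h1, h2⟩
    constructor <;> nlinarith
  obtain ⟨ac0, ac1⟩ := mixed _ hAC
  obtain ⟨ad0, ad1⟩ := mixed _ hAD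
  obtain ⟨bc0, bc1⟩ := mixed _ hBC
  obtain ⟨bd0, bd1⟩ := mixed _ hBD
  have ab0 : 0 ≤ dist A B^2 - 4 := by nlinarith [hAB.1]
  have ab1 : 4 + (dist A B^2 - 4) ≤ 4.02 := by
    have := hAB.1; have := hAB.2
    nlinarith
  have cd0 : 0 ≤ dist C D^2 - (2*(t-1))^2 := by
    have := hCD.1
    nlinarith
  have cd1 : (2*(t-1))^2 + (dist C D^2 - (2*(t-1))^2) ≤ 0.695 := by
    have := hCD.1; have := hCD.2
    nlinarith
  have hq : 0.686 ≤ (2*(t-1))^2 := by nlinarith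
  have r3 : (t-1)^3 = 5*t - 7 := by
    have : (t-1)^3 = t * t^2 - 3*t^2 + 3*t - 1 := by ring
    rw [this, s2]; ring
  have main := main_ineq (r := t-1) (by linarith) (by rw [r3]; linarith) (by rw [r3]; linarith) hq
    ab0 ac0 ad0 bc0 bd0 cd0 ab1 ac1 ad1 bc1 bd1 cd1
  have m0 : (1 + (t-1))^2 = 2 := by rw [← s2]; ring
  have P0 := parts haff₀ (r := t-1) (by linarith)
    (by rw [hAB₀]) (by rw [hAC₀, m0]) (by rw [hAD₀, m0]) (by rw [hBC₀, m0]) (by rw [hBD₀, m0])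
    (by rw [hCD₀]) (by norm_num) le_rfl le_rfl le_rfl le_rfl hq (by norm_num) (by norm_num)
    (by norm_num) (by norm_num) (by norm_num) (by linarith)
  have P1 := parts haff (r := t-1) (by linarith)
    (add_sub_cancel _ _).symm (add_sub_cancel _ _).symm (add_sub_cancel _ _).symm
    (add_sub_cancel _ _).symm (add_sub_cancel _ _).symm (add_sub_cancel _ _).symm
    (by linarith) (by linarith) (by linarith) (by linarith) (by linarith) (by linarith)
    ab1 ac1 ad1 bc1 bd1 cd1
  refine (dens_le A B C D 1 1 (t-1) (t-1)).trans ?_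
  rw [dens_eq (by rw [hAB₀]; norm_num) (by rw [hAC₀]) (by rw [hAD₀]) (by rw [hBC₀]) (by rw [hBD₀])
    (by rw [hCD₀]; linarith), P0, P1]
  refine div_le_div_of_nonneg_right ?_ ENNReal.toReal_nonneg
  norm_num at main ⊢
  exact main
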